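/- If (A_1, ..., A_{p+1}) is an irreducible tuple of matrices in gl(n, ℂ) (n ≥ 2) with A_1 + ⋯ + A_{p+1} = 0, then for every j one has ∑_{i ≠ j} r_i ≥ n, where r_i = min_{λ∈ℂ} rank(A_i − λI). -/

import Mathlib

open Matrix

theorem finrank_finset_sup_aux {ι : Type*} {n : ℕ} (s : Finset ι)
    (f : ι → Submodule ℂ (Fin n → ℂ)) :
    Module.finrank ℂ (s.sup f : Submodule ℂ (Fin n → ℂ)) ≤ ∑ i ∈ s, Module.finrank ℂ (f i) := by
  classical
  induction s using Finset.induction_on with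
  | empty => simp
  | insert a s ha ih =>
    rw [Finset.sup_insert, Finset.sum_insert ha]
    exact (Submodule.finrank_add_le_finrank_add_finrank _ _).trans (by omega)

theorem stmt18 (p n : ℕ) (hn : 2 ≤ n) (A : Fin (p + 1) → Matrix (Fin n) (Fin n) ℂ)
    (hsum : ∑ j, A j = 0)
    (hirr : ∀ V : Submodule ℂ (Fin n → ℂ),
      (∀ j, ∀ v ∈ V, Matrix.toLin' (A j) v ∈ V) → V = ⊥ ∨ V = ⊤) :
    ∀ j, n ≤ ∑ i ∈ Finset.univ.erase j,
      sInf (Set.range fun lam : ℂ => (A i - lam • (1 : Matrix (Fin n) (Fin n) ℂ)).rank) := by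
  intro j
  have hex : ∀ i, ∃ lam : ℂ, (A i - lam • (1 : Matrix (Fin n) (Fin n) ℂ)).rank =
      sInf (Set.range fun lam : ℂ => (A i - lam • (1 : Matrix (Fin n) (Fin n) ℂ)).rank) :=
    fun i => Nat.sInf_mem (Set.range_nonempty _)
  choose lam hlam using hex
  -- invariance under all but one matrix is enough
  have key : ∀ V : Submodule ℂ (Fin n → ℂ),
      (∀ i, i ≠ j → ∀ v ∈ V, Matrix.toLin' (A i) v ∈ V) → V = ⊥ ∨ V = ⊤ := by
    intro V hV
    apply hirr
    intro i v hv
    by_cases hij : i = j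
    · subst hij
      have h1 : A i = -∑ k ∈ Finset.univ.erase i, A k := by
        rw [eq_neg_iff_add_eq_zero, Finset.add_sum_erase _ _ (Finset.mem_univ i), hsum]
      rw [h1, map_neg, map_sum, LinearMap.neg_apply, LinearMap.sum_apply]
      exact V.neg_mem (V.sum_mem fun k hk => hV k (Finset.ne_of_mem_erase hk) v hv)
    · exact hV i hij v hv
  set f : Fin (p + 1) → Submodule ℂ (Fin n → ℂ) := fun i =>
    LinearMap.range (Matrix.toLin' (A i - lam i • (1 : Matrix (Fin n) (Fin n) ℂ))) with hf
  have happ : ∀ i v, Matrix.toLin' (A i) v =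
      Matrix.toLin' (A i - lam i • (1 : Matrix (Fin n) (Fin n) ℂ)) v + lam i • v := by
    intro i v
    simp
  have hW := finrank_finset_sup_aux (Finset.univ.erase j) f
  have hr : ∑ i ∈ Finset.univ.erase j, Module.finrank ℂ (f i) = ∑ i ∈ Finset.univ.erase j,
      sInf (Set.range fun lam : ℂ => (A i - lam • (1 : Matrix (Fin n) (Fin n) ℂ)).rank) :=
    Finset.sum_congr rfl fun i _ => hlam i
  rw [← hr]
  have hle : ∀ i, i ≠ j → f i ≤ (Finset.univ.erase j).sup f := fun i hi =>
    Finset.le_sup (f := f) (Finset.mem_erase.2 ⟨hi, Finset.mem_univ i⟩)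
  rcases key ((Finset.univ.erase j).sup f) (by
    intro i hi v hv
    rw [happ]
    exact Submodule.add_mem _ (hle i hi ⟨v, rfl⟩) (Submodule.smul_mem _ _ hv)) with h | h
  · exfalso
    let v : Fin n → ℂ := Pi.single ⟨0, by omega⟩ 1
    have hv : v ≠ 0 := by simp [v]
    have h1 := finrank_span_singleton (K := ℂ) hv
    rcases key (Submodule.span ℂ {v}) (by
      intro i hi w hw
      have h0 : Matrix.toLin' (A i - lam i • (1 : Matrix (Fin n) (Fin n) ℂ)) w = 0 := by
        have := hle i hi ⟨w, rfl⟩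
        rwa [h, Submodule.mem_bot] at this
      rw [happ, h0, zero_add]
      exact Submodule.smul_mem _ _ hw) with h2 | h2
    · rw [h2, finrank_bot] at h1
      omega
    · rw [h2, finrank_top, Module.finrank_fin_fun] at h1
      omega
  · rw [h, finrank_top, Module.finrank_fin_fun] at hW
    exact hW
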